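/- arXiv:2305.07782 — 2 statements merged into one kernel-verified Lean document; each statement's English description precedes it below -/
import Mathlib

section
/- Let ι be a finite type, K a positive natural number, and f : Finset ι → ℝ a normalized, monotone, submodular set function. Let S_0 = ∅ and, for k = 1,…,K, let S_k = S_{k-1} ∪ {a_k} where a_k ∉ S_{k-1} satisfies f(S_{k-1} ∪ {a_k}) ≥ f(S_{k-1} ∪ {a}) for every a ∉ S_{k-1} (greedy selection). Then for every T ⊆ ι with |T| ≤ K one has f(S_K) ≥ (1 − e⁻¹)·f(T). -/
/-- The marginal gain of `b` decreases when the base set `S` grows to `S ∪ U`. -/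
theorem marginal_union_le {ι : Type*} [DecidableEq ι] {f : Finset ι → ℝ}
    (hsub : ∀ (S : Finset ι) (a b : ι), a ∉ S → b ∉ S → a ≠ b →
      f (insert a S) - f S ≥ f (insert a (insert b S)) - f (insert b S))
    (S U : Finset ι) {b : ι} (hb : b ∉ S ∪ U) :
    f (insert b (S ∪ U)) - f (S ∪ U) ≤ f (insert b S) - f S := by
  induction U using Finset.induction_on with
  | empty => simp
  | insert c U _ ih =>
    rw [Finset.union_insert] at hb ⊢
    obtain ⟨hbc, hbU⟩ : b ≠ c ∧ b ∉ S ∪ U := by simpa only [Finset.mem_insert, not_or] using hb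
    by_cases hc : c ∈ S ∪ U
    · rw [Finset.insert_eq_of_mem hc]
      exact ih hbU
    · exact (hsub (S ∪ U) b c hbU hc hbc).trans (ih hbU)

/-- If every marginal gain over `S` is at most `m`, adjoining `T` to `S` increases a submodular
function by at most `T.card * m`. -/
theorem union_le_add_card_mul {ι : Type*} [DecidableEq ι] {f : Finset ι → ℝ}
    (hsub : ∀ (S : Finset ι) (a b : ι), a ∉ S → b ∉ S → a ≠ b →
      f (insert a S) - f S ≥ f (insert a (insert b S)) - f (insert b S))
    (S T : Finset ι) {m : ℝ} (hm : 0 ≤ m) (hgain : ∀ b, b ∉ S → f (insert b S) - f S ≤ m) :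
    f (S ∪ T) ≤ f S + T.card * m := by
  induction T using Finset.induction_on with
  | empty => simp
  | insert b T hbT ih =>
    rw [Finset.union_insert, Finset.card_insert_of_notMem hbT]
    push_cast
    by_cases hb : b ∈ S ∪ T
    · rw [Finset.insert_eq_of_mem hb]
      linarith
    · have hbS : b ∉ S := fun h => hb (Finset.mem_union_left T h)
      linarith [marginal_union_le hsub S T hb, hgain b hbS]

/-- **Nemhauser–Wolsey–Fisher greedy guarantee.**
For a normalized, monotone, submodular set function `f` on a finite ground set,
the greedy algorithm run for `K` steps produces a set `Sg K` with
`f (Sg K) ≥ (1 - e⁻¹) · f T` for every set `T` of cardinality at most `K`. -/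
theorem greedy_near_optimal
    {ι : Type*} [Fintype ι] [DecidableEq ι]
    (K : ℕ) (hK : 0 < K)
    (f : Finset ι → ℝ)
    (hnorm : f ∅ = 0)
    (hmono : ∀ S T : Finset ι, S ⊆ T → f S ≤ f T)
    (hsub : ∀ (S : Finset ι) (a b : ι), a ∉ S → b ∉ S → a ≠ b →
      f (insert a S) - f S ≥ f (insert a (insert b S)) - f (insert b S))
    (Sg : ℕ → Finset ι) (a : ℕ → ι)
    (hS0 : Sg 0 = ∅)
    (hstep : ∀ k, k < K → a k ∉ Sg k ∧ Sg (k + 1) = insert (a k) (Sg k) ∧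
      ∀ b, b ∉ Sg k → f (insert b (Sg k)) ≤ f (insert (a k) (Sg k))) :
    ∀ T : Finset ι, T.card ≤ K → (1 - Real.exp (-1)) * f T ≤ f (Sg K) := by
  intro T hT
  have hKpos : (0 : ℝ) < K := by exact_mod_cast hK
  have hKone : (1 : ℝ) ≤ K := by exact_mod_cast hK
  have hratio : (0 : ℝ) ≤ 1 - 1 / K := by
    rw [sub_nonneg, div_le_one hKpos]
    exact hKone
  have hgap : ∀ k < K, f T - f (Sg (k + 1)) ≤ (1 - 1 / K) * (f T - f (Sg k)) := by
    intro k hk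
    obtain ⟨-, hSk, hbest⟩ := hstep k hk
    have hm : 0 ≤ f (Sg (k + 1)) - f (Sg k) := by
      rw [hSk, sub_nonneg]
      exact hmono _ _ (Finset.subset_insert _ _)
    have hunion := union_le_add_card_mul hsub (Sg k) T hm fun b hb => by
      rw [hSk]
      exact sub_le_sub_right (hbest b hb) _
    have hcard : (T.card : ℝ) * (f (Sg (k + 1)) - f (Sg k)) ≤
        K * (f (Sg (k + 1)) - f (Sg k)) := by gcongr
    have hdiv : (f T - f (Sg k)) / K ≤ f (Sg (k + 1)) - f (Sg k) := by
      rw [div_le_iff₀' hKpos]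
      linarith [hmono T (Sg k ∪ T) Finset.subset_union_right]
    rw [sub_mul, one_mul, one_div_mul_eq_div]
    linarith
  have hdecay : ∀ k ≤ K, f T - f (Sg k) ≤ (1 - 1 / K) ^ k * f T := by
    intro k
    induction k with
    | zero => simp [hS0, hnorm]
    | succ k ih =>
      intro hk
      calc f T - f (Sg (k + 1)) ≤ (1 - 1 / K) * (f T - f (Sg k)) := hgap k hk
        _ ≤ (1 - 1 / K) * ((1 - 1 / K) ^ k * f T) := by
          gcongr
          exact ih (Nat.le_of_succ_le hk)
        _ = (1 - 1 / K) ^ (k + 1) * f T := by ring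
  have hfT : 0 ≤ f T := hnorm ▸ hmono ∅ T (Finset.empty_subset T)
  have hexp := mul_le_mul_of_nonneg_right (Real.one_sub_div_pow_le_exp_neg hKone) hfT
  linarith [hdecay K le_rfl]
end

section
/- Let (Ω, P) be a probability space, r : Ω → ℝ a random variable with r² integrable, and θ : Ω → ℝ a random variable whose law is the uniform distribution on [0, 2π), with r and θ independent. Define the random vector y : Ω → ℝ² by y(ω) = r(ω)·(cos θ(ω), sin θ(ω)). Then for any two unit vectors u, v ∈ ℝ², E[‖y‖²] ≥ E[‖y − ⟨y,u⟩u‖² + ‖y − ⟨y,v⟩v‖²]. -/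
open Real MeasureTheory ProbabilityTheory RealInnerProductSpace

theorem norm_sub_inner_smul_sq {E : Type*} [NormedAddCommGroup E] [InnerProductSpace ℝ E]
    {u : E} (hu : ‖u‖ = 1) (x : E) : ‖x - ⟪x, u⟫ • u‖ ^ 2 = ‖x‖ ^ 2 - ⟪x, u⟫ ^ 2 := by
  rw [norm_sub_sq_real, inner_smul_right, norm_smul, hu, mul_one, Real.norm_eq_abs, sq_abs]
  ring

theorem integral_add_mul_cos_sin_sq (a b : ℝ) :
    ∫ t in (0 : ℝ)..2 * π, (cos t * a + sin t * b) ^ 2 = π * (a ^ 2 + b ^ 2) := by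
  have h (t : ℝ) : (cos t * a + sin t * b) ^ 2
      = a ^ 2 * cos t ^ 2 + 2 * a * b * (sin t * cos t) + b ^ 2 * sin t ^ 2 := by ring
  simp_rw [h]
  rw [intervalIntegral.integral_add, intervalIntegral.integral_add,
    intervalIntegral.integral_const_mul, intervalIntegral.integral_const_mul,
    intervalIntegral.integral_const_mul, integral_cos_sq, integral_sin_sq,
    integral_sin_mul_cos₁]
  · simp
    ring
  all_goals exact Continuous.intervalIntegrable (by fun_prop) _ _

theorem integral_cos_sin_sq_of_uniform {Ω : Type*} [MeasurableSpace Ω] {P : Measure Ω}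
    {θ : Ω → ℝ} (hθ : Measurable θ)
    (hlaw : Measure.map θ P
      = (ENNReal.ofReal (1 / (2 * π))) • volume.restrict (Set.Ico 0 (2 * π))) (a b : ℝ) :
    ∫ ω, (cos (θ ω) * a + sin (θ ω) * b) ^ 2 ∂P = (a ^ 2 + b ^ 2) / 2 := by
  have hmap := integral_map (μ := P) hθ.aemeasurable
    (f := fun t => (cos t * a + sin t * b) ^ 2)
    (Continuous.aestronglyMeasurable (by fun_prop))
  rw [← hmap, hlaw, integral_smul_measure, integral_Ico_eq_integral_Ioc,
    ← intervalIntegral.integral_of_le (by positivity), integral_add_mul_cos_sin_sq,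
    ENNReal.toReal_ofReal (by positivity), smul_eq_mul]
  field_simp

/-- **Lemma 1.** Let `y = r·(cos θ, sin θ)` where `r² ` is integrable, `θ` is uniformly
distributed on `[0, 2π)`, and `r, θ` are independent. Then for any two unit vectors
`u, v ∈ ℝ²`, `E[‖y‖²] ≥ E[‖y − ⟨y,u⟩u‖² + ‖y − ⟨y,v⟩v‖²]`. -/
theorem expected_energy_ge_sum_residuals
    {Ω : Type*} [MeasurableSpace Ω] (P : Measure Ω) [IsProbabilityMeasure P]
    (r θ : Ω → ℝ) (hr : Measurable r) (hθ : Measurable θ)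
    (hr2 : Integrable (fun ω => (r ω) ^ 2) P)
    (hlaw : Measure.map θ P
      = (ENNReal.ofReal (1 / (2 * π))) • volume.restrict (Set.Ico 0 (2 * π)))
    (hindep : IndepFun r θ P)
    (y : Ω → EuclideanSpace ℝ (Fin 2))
    (hy : ∀ ω, y ω
      = r ω • (WithLp.equiv 2 (Fin 2 → ℝ)).symm ![Real.cos (θ ω), Real.sin (θ ω)])
    (u v : EuclideanSpace ℝ (Fin 2)) (hu : ‖u‖ = 1) (hv : ‖v‖ = 1) :
    ∫ ω, ‖y ω‖ ^ 2 ∂P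
      ≥ ∫ ω, (‖y ω - ⟪y ω, u⟫ • u‖ ^ 2 + ‖y ω - ⟪y ω, v⟫ • v‖ ^ 2) ∂P := by
  have hnorm (ω : Ω) : ‖y ω‖ ^ 2 = r ω ^ 2 := by
    rw [hy, EuclideanSpace.norm_sq_eq]
    simp [Fin.sum_univ_two, mul_pow]
    rw [← mul_add, cos_sq_add_sin_sq, mul_one]
  have hinner (w : EuclideanSpace ℝ (Fin 2)) (ω : Ω) :
      ⟪y ω, w⟫ ^ 2 = r ω ^ 2 * (cos (θ ω) * w 0 + sin (θ ω) * w 1) ^ 2 := by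
    rw [hy, inner_smul_left, PiLp.inner_apply]
    simp [Fin.sum_univ_two]
    ring
  have hproj_int (w : EuclideanSpace ℝ (Fin 2)) : Integrable (fun ω => ⟪y ω, w⟫ ^ 2) P := by
    have hnorm_int : Integrable (fun ω => r ω ^ 2 * ‖w‖ ^ 2) P := hr2.mul_const _
    refine hnorm_int.mono' ?_ (.of_forall fun ω => ?_)
    · simp_rw [hinner]
      exact Measurable.aestronglyMeasurable (by fun_prop)
    · rw [norm_pow, Real.norm_eq_abs, ← hnorm, ← mul_pow]
      gcongr
      exact abs_real_inner_le_norm _ _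
  have hproj (w : EuclideanSpace ℝ (Fin 2)) (hw : ‖w‖ = 1) :
      ∫ ω, ⟪y ω, w⟫ ^ 2 ∂P = (∫ ω, r ω ^ 2 ∂P) / 2 := by
    have hw' : w 0 ^ 2 + w 1 ^ 2 = 1 := by
      have := EuclideanSpace.norm_sq_eq w
      simpa [hw, Fin.sum_univ_two] using this.symm
    have hind : IndepFun (fun ω => r ω ^ 2)
        (fun ω => (cos (θ ω) * w 0 + sin (θ ω) * w 1) ^ 2) P :=
      hindep.comp (φ := fun x => x ^ 2) (ψ := fun t => (cos t * w 0 + sin t * w 1) ^ 2)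
        (by fun_prop) (by fun_prop)
    simp_rw [hinner]
    rw [hind.integral_fun_mul_eq_mul_integral (Measurable.aestronglyMeasurable (by fun_prop))
      (Measurable.aestronglyMeasurable (by fun_prop)),
      integral_cos_sin_sq_of_uniform hθ hlaw, hw']
    ring
  have hres_int (w : EuclideanSpace ℝ (Fin 2)) :
      Integrable (fun ω => r ω ^ 2 - ⟪y ω, w⟫ ^ 2) P := hr2.sub (hproj_int w)
  simp_rw [norm_sub_inner_smul_sq hu, norm_sub_inner_smul_sq hv, hnorm]
  rw [integral_add (hres_int u) (hres_int v),
    integral_sub hr2 (hproj_int u), integral_sub hr2 (hproj_int v), hproj u hu, hproj v hv]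
  linarith
end
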